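/- (Cut elimination for LNS_Kt) For all contexts G, H, all multisets Γ, Δ, Σ, Π and every formula A: if G ⇗ Γ ⇒ Δ,A and H ⇗ A,Σ ⇒ Π are both derivable in LNS_Kt and the linear nested sequents G ⇗ Γ ⇒ Δ,A and H ⇗ A,Σ ⇒ Π are structurally equivalent, then (G ⊕ H) ⇗ Γ,Σ ⇒ Δ,Π is derivable in LNS_Kt. -/

import Mathlib

/-- Formulae of tense logic: atoms (indexed by naturals), ⊥, →, □, ◇, ■, ◆. -/
inductive Formula : Type
  | atom : ℕ → Formula
  | bot : Formula
  | imp : Formula → Formula → Formula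
  | box : Formula → Formula
  | dia : Formula → Formula
  | bbox : Formula → Formula
  | bdia : Formula → Formula

def Formula.neg (A : Formula) : Formula := A.imp .bot
def Formula.and (A B : Formula) : Formula := (A.imp B.neg).neg
def Formula.or (A B : Formula) : Formula := A.neg.imp B
def Formula.top : Formula := Formula.bot.imp .bot

/-- Formulas built from atoms, ⊥, →, □, ■ only (no diamonds). -/
def Formula.NoDia : Formula → Prop
  | .atom _ => True
  | .bot => True
  | .imp A B => A.NoDia ∧ B.NoDia
  | .box A => A.NoDia
  | .dia _ => False
  | .bbox A => A.NoDia
  | .bdia _ => False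

/-- Structural connectives: `up` is ↗ and `dn` is ↙. -/
inductive Dir : Type
  | up
  | dn

/-- Linear nested sequents: a nonempty list of components `Γ ⇒ Δ`
joined by the structural connectives ↗ (`up`) and ↙ (`dn`). -/
inductive LNS : Type
  | single (Γ Δ : Multiset Formula) : LNS
  | up (Γ Δ : Multiset Formula) (S : LNS) : LNS
  | dn (Γ Δ : Multiset Formula) (S : LNS) : LNS

/-- A (possibly empty) context: a list of components, each together with the
structural connective joining it to what follows. -/
abbrev Ctx := List (Multiset Formula × Multiset Formula × Dir)

/-- `plug G S` is the linear nested sequent `G ⇗ S` (just `S` when `G` is empty). -/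
def plug : Ctx → LNS → LNS
  | [], S => S
  | (Γ, Δ, Dir.up) :: G, S => LNS.up Γ Δ (plug G S)
  | (Γ, Δ, Dir.dn) :: G, S => LNS.dn Γ Δ (plug G S)

/-- The structural connective joining the context to what follows it (none if empty). -/
def lastDir : Ctx → Option Dir
  | [] => none
  | [(_, _, d)] => some d
  | _ :: G => lastDir G

/-- The calculus LNS_Kt. -/
inductive Deriv : LNS → Prop
  | id (G : Ctx) (Γ Δ : Multiset Formula) (p : ℕ) :
      Deriv (plug G (.single (.atom p ::ₘ Γ) (.atom p ::ₘ Δ)))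
  | botL (G : Ctx) (Γ Δ : Multiset Formula) :
      Deriv (plug G (.single (.bot ::ₘ Γ) Δ))
  | ew (G : Ctx) (Θ Λ : Multiset Formula) (d : Dir) (Γ Δ : Multiset Formula) :
      Deriv (plug G (.single Θ Λ)) →
      Deriv (plug (G ++ [(Θ, Λ, d)]) (.single Γ Δ))
  | impR (G : Ctx) (Γ Δ : Multiset Formula) (A B : Formula) :
      Deriv (plug G (.single (A ::ₘ Γ) (B ::ₘ A.imp B ::ₘ Δ))) →
      Deriv (plug G (.single Γ (A.imp B ::ₘ Δ)))
  | impL (G : Ctx) (Γ Δ : Multiset Formula) (A B : Formula) :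
      Deriv (plug G (.single (B ::ₘ A.imp B ::ₘ Γ) Δ)) →
      Deriv (plug G (.single (A.imp B ::ₘ Γ) (A ::ₘ Δ))) →
      Deriv (plug G (.single (A.imp B ::ₘ Γ) Δ))
  | boxR1 (G : Ctx) (Γ Δ Θ Λ : Multiset Formula) (A : Formula) :
      Deriv (plug G (.dn Γ (A ::ₘ Δ) (.single Θ (A.box ::ₘ Λ)))) →
      Deriv (plug G (.dn Γ Δ (.up Θ (A.box ::ₘ Λ) (.single 0 {A})))) →
      Deriv (plug G (.dn Γ Δ (.single Θ (A.box ::ₘ Λ))))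
  | bboxR1 (G : Ctx) (Γ Δ Θ Λ : Multiset Formula) (A : Formula) :
      Deriv (plug G (.up Γ (A ::ₘ Δ) (.single Θ (A.bbox ::ₘ Λ)))) →
      Deriv (plug G (.up Γ Δ (.dn Θ (A.bbox ::ₘ Λ) (.single 0 {A})))) →
      Deriv (plug G (.up Γ Δ (.single Θ (A.bbox ::ₘ Λ))))
  | boxR2 (G : Ctx) (Γ Δ : Multiset Formula) (A : Formula) :
      lastDir G ≠ some Dir.dn →
      Deriv (plug G (.up Γ (A.box ::ₘ Δ) (.single 0 {A}))) →
      Deriv (plug G (.single Γ (A.box ::ₘ Δ)))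
  | bboxR2 (G : Ctx) (Γ Δ : Multiset Formula) (A : Formula) :
      lastDir G ≠ some Dir.up →
      Deriv (plug G (.dn Γ (A.bbox ::ₘ Δ) (.single 0 {A}))) →
      Deriv (plug G (.single Γ (A.bbox ::ₘ Δ)))
  | boxL1 (G : Ctx) (Γ Δ Θ Λ : Multiset Formula) (A : Formula) :
      Deriv (plug G (.up (A.box ::ₘ Γ) Δ (.single (A ::ₘ Θ) Λ))) →
      Deriv (plug G (.up (A.box ::ₘ Γ) Δ (.single Θ Λ)))
  | bboxL1 (G : Ctx) (Γ Δ Θ Λ : Multiset Formula) (A : Formula) :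
      Deriv (plug G (.dn (A.bbox ::ₘ Γ) Δ (.single (A ::ₘ Θ) Λ))) →
      Deriv (plug G (.dn (A.bbox ::ₘ Γ) Δ (.single Θ Λ)))
  | boxL2 (G : Ctx) (Γ Δ Θ Λ : Multiset Formula) (A : Formula) :
      Deriv (plug G (.single (A ::ₘ Γ) Δ)) →
      Deriv (plug G (.dn Γ Δ (.single (A.box ::ₘ Θ) Λ)))
  | bboxL2 (G : Ctx) (Γ Δ Θ Λ : Multiset Formula) (A : Formula) :
      Deriv (plug G (.single (A ::ₘ Γ) Δ)) →
      Deriv (plug G (.up Γ Δ (.single (A.bbox ::ₘ Θ) Λ)))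

/-- Two linear nested sequents are structurally equivalent if they have the same
number of components joined by the same sequence of structural connectives. -/
def structEquiv : LNS → LNS → Prop
  | .single _ _, .single _ _ => True
  | .up _ _ S, .up _ _ T => structEquiv S T
  | .dn _ _ S, .dn _ _ T => structEquiv S T
  | _, _ => False

/-- The merge of two (structurally equivalent) linear nested sequents, taking
componentwise multiset unions of antecedents and succedents. -/
def merge : LNS → LNS → LNS
  | .single Γ Δ, .single Θ Λ => .single (Γ + Θ) (Δ + Λ)
  | .up Γ Δ S, .up Θ Λ T => .up (Γ + Θ) (Δ + Λ) (merge S T)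
  | .dn Γ Δ S, .dn Θ Λ T => .dn (Γ + Θ) (Δ + Λ) (merge S T)
  | S, _ => S

/-! ### An auxiliary set-based calculus, with the last component at the head of the list -/

namespace Aux

/-- The converse direction. -/
def flip : Dir → Dir
  | .up => .dn
  | .dn => .up

/-- The box belonging to a direction. -/
def boxd : Dir → Formula → Formula
  | .up, A => A.box
  | .dn, A => A.bbox

theorem boxd_inj {d e : Dir} {A B : Formula} (h : boxd d A = boxd e B) : d = e ∧ A = B := by
  cases d <;> cases e <;> simp_all [boxd]

/-- A component; `d` is the connective joining it to the previous component. -/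
structure Comp where
  L : Set Formula
  R : Set Formula
  d : Dir

def Comp.addL (c : Comp) (A : Formula) : Comp := ⟨insert A c.L, c.R, c.d⟩
def Comp.addR (c : Comp) (A : Formula) : Comp := ⟨c.L, insert A c.R, c.d⟩

inductive SD : List Comp → Prop
  | id (p : ℕ) (c : Comp) (G : List Comp) : .atom p ∈ c.L → .atom p ∈ c.R → SD (c :: G)
  | bot (c : Comp) (G : List Comp) : .bot ∈ c.L → SD (c :: G)
  | ew (c c1 : Comp) (G : List Comp) : SD (c1 :: G) → SD (c :: c1 :: G)
  | impR (A B : Formula) (c : Comp) (G : List Comp) : A.imp B ∈ c.R →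
      SD ((c.addL A).addR B :: G) → SD (c :: G)
  | impL (A B : Formula) (c : Comp) (G : List Comp) : A.imp B ∈ c.L →
      SD (c.addL B :: G) → SD (c.addR A :: G) → SD (c :: G)
  | boxR (d : Dir) (A : Formula) (c : Comp) (G : List Comp) : boxd d A ∈ c.R →
      SD (⟨∅, {A}, d⟩ :: c :: G) →
      (∀ c1 G1, G = c1 :: G1 → c.d = flip d → SD (c :: c1.addR A :: G1)) →
      SD (c :: G)
  | boxL1 (d : Dir) (A : Formula) (c c1 : Comp) (G : List Comp) : c.d = d → boxd d A ∈ c1.L →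
      SD (c.addL A :: c1 :: G) → SD (c :: c1 :: G)
  | boxL2 (d : Dir) (A : Formula) (c c1 : Comp) (G : List Comp) : c.d = flip d →
      boxd d A ∈ c.L → SD (c1.addL A :: G) → SD (c :: c1 :: G)

abbrev Pr := Formula → List Comp → Prop

/-- `J PL PR S S'`: every formula of `S` occurs at the same place in `S'`, or satisfies the side
condition `PL` / `PR` relative to the part of `S'` up to this component. -/
inductive J (PL PR : Pr) : List Comp → List Comp → Prop
  | nil : J PL PR [] []
  | cons (c c' : Comp) (G G' : List Comp) : c.d = c'.d →
      (∀ X ∈ c.L, X ∈ c'.L ∨ PL X (c' :: G')) →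
      (∀ X ∈ c.R, X ∈ c'.R ∨ PR X (c' :: G')) → J PL PR G G' → J PL PR (c :: G) (c' :: G')

abbrev PF : Pr := fun _ _ => False
abbrev Le := J PF PF

theorem Le.refl : ∀ S, Le S S
  | [] => .nil
  | c :: G => .cons c c G G rfl (fun _ h => .inl h) (fun _ h => .inl h) (Le.refl G)

theorem Le.cons' {c c' : Comp} {G G' : List Comp} (h : c.d = c'.d) (hl : c.L ⊆ c'.L)
    (hr : c.R ⊆ c'.R) (hG : Le G G') : Le (c :: G) (c' :: G') :=
  .cons _ _ _ _ h (fun _ h => .inl (hl h)) (fun _ h => .inl (hr h)) hG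

theorem Le.head {c c' : Comp} {G G' : List Comp} (h : Le (c :: G) (c' :: G')) :
    c.d = c'.d ∧ c.L ⊆ c'.L ∧ c.R ⊆ c'.R ∧ Le G G' := by
  cases h with
  | cons _ _ _ _ h1 h2 h3 h4 =>
    exact ⟨h1, fun X hX => (h2 X hX).resolve_right (fun h => h),
      fun X hX => (h3 X hX).resolve_right (fun h => h), h4⟩

def Mono (P : Pr) : Prop := ∀ X S S', Le S S' → P X S → P X S'

theorem mono_PF : Mono PF := fun _ _ _ _ h => h

section
variable {PL PR : Pr}

/-- Change the head components. -/
theorem J.head_mod (mL : Mono PL) (mR : Mono PR) {c c' : Comp} {G G' : List Comp}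
    (h : J PL PR (c :: G) (c' :: G')) {e e' : Comp} (he : e.d = e'.d) (hd : c'.d = e'.d)
    (hl : c'.L ⊆ e'.L) (hr : c'.R ⊆ e'.R)
    (hl' : ∀ X ∈ e.L, X ∈ c.L ∨ X ∈ e'.L) (hr' : ∀ X ∈ e.R, X ∈ c.R ∨ X ∈ e'.R) :
    J PL PR (e :: G) (e' :: G') := by
  cases h with
  | cons _ _ _ _ h1 h2 h3 h4 =>
    have hle : Le (c' :: G') (e' :: G') := Le.cons' hd hl hr (Le.refl _)
    refine .cons _ _ _ _ he ?_ ?_ h4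
    · intro X hX
      rcases hl' X hX with h | h
      · rcases h2 X h with h | h
        · exact .inl (hl h)
        · exact .inr (mL _ _ _ hle h)
      · exact .inl h
    · intro X hX
      rcases hr' X hX with h | h
      · rcases h3 X h with h | h
        · exact .inl (hr h)
        · exact .inr (mR _ _ _ hle h)
      · exact .inl h

theorem J.addL (mL : Mono PL) (mR : Mono PR) {c c' : Comp} {G G' : List Comp}
    (h : J PL PR (c :: G) (c' :: G')) (A : Formula) :
    J PL PR (c.addL A :: G) (c'.addL A :: G') := by
  have hd : c.d = c'.d := by cases h; assumption
  refine h.head_mod mL mR hd rfl (Set.subset_insert _ _) subset_rfl ?_ (fun X h => .inl h)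
  rintro X (rfl | h)
  · exact .inr (Set.mem_insert _ _)
  · exact .inl h

theorem J.addR (mL : Mono PL) (mR : Mono PR) {c c' : Comp} {G G' : List Comp}
    (h : J PL PR (c :: G) (c' :: G')) (A : Formula) :
    J PL PR (c.addR A :: G) (c'.addR A :: G') := by
  have hd : c.d = c'.d := by cases h; assumption
  refine h.head_mod mL mR hd rfl subset_rfl (Set.subset_insert _ _) (fun X h => .inl h) ?_
  rintro X (rfl | h)
  · exact .inr (Set.mem_insert _ _)
  · exact .inl h

theorem J.addR2 (mL : Mono PL) (mR : Mono PR) {c c' c1 c1' : Comp} {G G' : List Comp}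
    (h : J PL PR (c :: c1 :: G) (c' :: c1' :: G')) (A : Formula) :
    J PL PR (c :: c1.addR A :: G) (c' :: c1'.addR A :: G') := by
  cases h with
  | cons _ _ _ _ h1 h2 h3 h4 =>
    have hle : Le (c' :: c1' :: G') (c' :: c1'.addR A :: G') :=
      Le.cons' rfl subset_rfl subset_rfl
        (Le.cons' rfl subset_rfl (Set.subset_insert _ _) (Le.refl _))
    exact .cons _ _ _ _ h1 (fun X hX => (h2 X hX).imp (fun h => h) (mL _ _ _ hle))
      (fun X hX => (h3 X hX).imp (fun h => h) (mR _ _ _ hle)) (h4.addR mL mR A)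

/-- The generic permutation argument. -/
theorem gen (mL : Mono PL) (mR : Mono PR)
    (hidL : ∀ p c G, PL (.atom p) (c :: G) → SD (c :: G))
    (hidR : ∀ p c G, .atom p ∈ c.L → PR (.atom p) (c :: G) → SD (c :: G))
    (hbot : ∀ c G, PL .bot (c :: G) → SD (c :: G))
    (hRimp : ∀ A B c G, PR (.imp A B) (c :: G) → SD ((c.addL A).addR B :: G) → SD (c :: G))
    (hLimp : ∀ A B c G, PL (.imp A B) (c :: G) → SD (c.addL B :: G) → SD (c.addR A :: G) →
      SD (c :: G))
    (hRbox : ∀ d A c G, PR (boxd d A) (c :: G) → SD (⟨∅, {A}, d⟩ :: c :: G) →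
      (∀ c1 G1, G = c1 :: G1 → c.d = flip d → SD (c :: c1.addR A :: G1)) → SD (c :: G))
    (hL1 : ∀ d A c c1 G, PL (boxd d A) (c1 :: G) → c.d = d → SD (c.addL A :: c1 :: G) →
      SD (c :: c1 :: G))
    (hL2 : ∀ d A c c1 G, PL (boxd d A) (c :: c1 :: G) → c.d = flip d → SD (c1.addL A :: G) →
      SD (c :: c1 :: G))
    {S S' : List Comp} (h : SD S) (hJ : J PL PR S S') : SD S' := by
  induction h generalizing S' with
  | id p c G h1 h2 =>
    cases hJ with
    | cons _ c' _ G' e1 e2 e3 e4 =>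
      rcases e2 _ h1 with k | k
      · rcases e3 _ h2 with k' | k'
        · exact .id p _ _ k k'
        · exact hidR _ _ _ k k'
      · exact hidL _ _ _ k
  | bot c G h1 =>
    cases hJ with
    | cons _ c' _ G' e1 e2 e3 e4 =>
      rcases e2 _ h1 with k | k
      · exact .bot _ _ k
      · exact hbot _ _ k
  | ew c c1 G h1 ih =>
    cases hJ with
    | cons _ c' _ G' e1 e2 e3 e4 =>
      cases id e4 with
      | cons _ c1' _ G1' => exact .ew _ _ _ (ih e4)
  | impR A B c G h1 h2 ih =>
    cases id hJ with
    | cons _ c' _ G' e1 e2 e3 e4 =>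
      have k2 := ih ((hJ.addL mL mR A).addR mL mR B)
      rcases e3 _ h1 with k | k
      · exact .impR _ _ _ _ k k2
      · exact hRimp _ _ _ _ k k2
  | impL A B c G h1 h2 h3 ih1 ih2 =>
    cases id hJ with
    | cons _ c' _ G' e1 e2 e3 e4 =>
      have k1 := ih1 (hJ.addL mL mR B)
      have k2 := ih2 (hJ.addR mL mR A)
      rcases e2 _ h1 with k | k
      · exact .impL _ _ _ _ k k1 k2
      · exact hLimp _ _ _ _ k k1 k2
  | boxR d A c G h1 h2 h3 ih1 ih2 =>
    cases id hJ with
    | cons _ c' _ G' e1 e2 e3 e4 =>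
      have k1 : SD (⟨∅, {A}, d⟩ :: c' :: G') :=
        ih1 (.cons _ _ _ _ rfl (fun _ h => .inl h) (fun _ h => .inl h) hJ)
      have k2 : ∀ c1 G1, G' = c1 :: G1 → c'.d = flip d → SD (c' :: c1.addR A :: G1) := by
        rintro c1' G1' rfl hd
        cases id e4 with
        | cons c1 _ G1 _ => exact ih2 c1 G1 rfl (e1.trans hd) (hJ.addR2 mL mR A)
      rcases e3 _ h1 with k | k
      · exact .boxR _ _ _ _ k k1 k2
      · exact hRbox _ _ _ _ k k1 k2
  | boxL1 d A c c1 G hd h1 h2 ih =>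
    cases id hJ with
    | cons _ c' _ G' e1 e2 e3 e4 =>
      cases id e4 with
      | cons _ c1' _ G1' f1 f2 f3 f4 =>
        have k1 := ih (hJ.addL mL mR A)
        rcases f2 _ h1 with k | k
        · exact .boxL1 d A _ _ _ (e1.symm.trans hd) k k1
        · exact hL1 d A _ _ _ k (e1.symm.trans hd) k1
  | boxL2 d A c c1 G hd h1 h2 ih =>
    cases id hJ with
    | cons _ c' _ G' e1 e2 e3 e4 =>
      cases id e4 with
      | cons _ c1' _ G1' f1 f2 f3 f4 =>
        have k1 := ih (e4.addL mL mR A)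
        rcases e2 _ h1 with k | k
        · exact .boxL2 d A _ _ _ (e1.symm.trans hd) k k1
        · exact hL2 d A _ _ _ k (e1.symm.trans hd) k1

end

/-- Weakening and contraction. -/
theorem weak {S S' : List Comp} (h : SD S) (hJ : Le S S') : SD S' := by
  refine gen mono_PF mono_PF ?_ ?_ ?_ ?_ ?_ ?_ ?_ ?_ h hJ <;> intros <;> contradiction

/-- Side condition for cuts on `A`: the right premiss is derivable. -/
def CutR (A : Formula) : Pr
  | _, [] => False
  | X, c :: G => X = A ∧ SD (c.addL A :: G)

theorem Le.addL {c c' : Comp} {G G' : List Comp} (h : Le (c :: G) (c' :: G')) (A : Formula) :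
    Le (c.addL A :: G) (c'.addL A :: G') := J.addL mono_PF mono_PF h A
theorem Le.addR {c c' : Comp} {G G' : List Comp} (h : Le (c :: G) (c' :: G')) (A : Formula) :
    Le (c.addR A :: G) (c'.addR A :: G') := J.addR mono_PF mono_PF h A

theorem mono_CutR (A : Formula) : Mono (CutR A) := by
  rintro X S S' hle h
  cases id hle with
  | nil => exact h
  | cons c c' G G' => exact ⟨h.1, weak h.2 (hle.addL A)⟩

def Cut (A : Formula) : Prop := ∀ S S', SD S → J PF (CutR A) S S' → SD S'

theorem le_J {PL PR : Pr} {S S' : List Comp} (h : Le S S') : J PL PR S S' := by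
  induction h with
  | nil => exact .nil
  | cons c c' G G' h1 h2 h3 h4 ih =>
    exact .cons _ _ _ _ h1 (fun X hX => .inl ((h2 X hX).resolve_right (fun h => h)))
      (fun X hX => .inl ((h3 X hX).resolve_right (fun h => h))) ih

theorem Cut.last {A : Formula} (h : Cut A) {c : Comp} {G : List Comp}
    (h1 : SD (c.addR A :: G)) (h2 : SD (c.addL A :: G)) : SD (c :: G) := by
  refine h _ _ h1 (.cons _ _ _ _ rfl (fun _ h => .inl h) ?_ (le_J (Le.refl _)))
  rintro X (rfl | hX)
  · exact .inr ⟨rfl, h2⟩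
  · exact .inl hX

theorem Cut.inner {A : Formula} (h : Cut A) {c c1 : Comp} {G : List Comp}
    (h1 : SD (c :: c1.addR A :: G)) (h2 : SD (c1.addL A :: G)) : SD (c :: c1 :: G) := by
  refine h _ _ h1 (.cons _ _ _ _ rfl (fun _ h => .inl h) (fun _ h => .inl h)
    (.cons _ _ _ _ rfl (fun _ h => .inl h) ?_ (le_J (Le.refl _))))
  rintro X (rfl | hX)
  · exact .inr ⟨rfl, h2⟩
  · exact .inl hX

/-- Generic use of a right-hand side condition. -/
theorem J.right {A : Formula} {PL : Pr} {c : Comp} {G : List Comp} (h : PL A (c :: G)) :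
    J PL PF (c.addL A :: G) (c :: G) := by
  refine .cons _ _ _ _ rfl ?_ (fun _ h => .inl h) (le_J (Le.refl _))
  rintro X (rfl | hX)
  · exact .inr h
  · exact .inl hX

def ImpL (A B : Formula) : Pr
  | _, [] => False
  | X, c :: G => X = A.imp B ∧ SD ((c.addL A).addR B :: G)

theorem mono_ImpL (A B : Formula) : Mono (ImpL A B) := by
  rintro X S S' hle h
  cases id hle with
  | nil => exact h
  | cons c c' G G' => exact ⟨h.1, weak h.2 ((hle.addL A).addR B)⟩

theorem imp_right {A B : Formula} (hA : Cut A) (hB : Cut B) {c : Comp} {G : List Comp}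
    (h1 : SD ((c.addL A).addR B :: G)) (h2 : SD (c.addL (A.imp B) :: G)) : SD (c :: G) := by
  refine gen (mono_ImpL A B) mono_PF ?_ ?_ ?_ ?_ ?_ ?_ ?_ ?_ h2 (J.right ⟨rfl, h1⟩)
  · rintro p c G ⟨h, -⟩; cases h
  · intros; contradiction
  · rintro c G ⟨h, -⟩; cases h
  · intros; contradiction
  · rintro A' B' c G ⟨h, k⟩ k1 k2
    cases h
    refine hA.last k2 (hB.last k (weak k1 ?_))
    exact Le.cons' rfl (Set.insert_subset_insert (Set.subset_insert _ _)) subset_rfl (Le.refl _)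
  · intros; contradiction
  · rintro d A' c c1 G ⟨h, -⟩; cases d <;> cases h
  · rintro d A' c c1 G ⟨h, -⟩; cases d <;> cases h

def BoxL (d : Dir) (A : Formula) : Pr
  | _, [] => False
  | X, c :: G => X = boxd d A ∧ SD (⟨∅, {A}, d⟩ :: c :: G) ∧
      (∀ c1 G1, G = c1 :: G1 → c.d = flip d → SD (c :: c1.addR A :: G1))

theorem mono_BoxL (d : Dir) (A : Formula) : Mono (BoxL d A) := by
  rintro X S S' hle h
  cases id hle with
  | nil => exact h
  | cons c c' G G' e1 e2 e3 e4 =>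
    refine ⟨h.1, weak h.2.1 (Le.cons' rfl subset_rfl subset_rfl hle), ?_⟩
    rintro c1' G1' rfl hd
    cases id e4 with
    | cons c1 _ G1 _ =>
      exact weak (h.2.2 c1 G1 rfl (e1.trans hd)) (J.addR2 mono_PF mono_PF hle A)

theorem box_right {d : Dir} {A : Formula} (hA : Cut A) {c : Comp} {G : List Comp}
    (h1 : SD (⟨∅, {A}, d⟩ :: c :: G))
    (h1' : ∀ c1 G1, G = c1 :: G1 → c.d = flip d → SD (c :: c1.addR A :: G1))
    (h2 : SD (c.addL (boxd d A) :: G)) : SD (c :: G) := by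
  refine gen (mono_BoxL d A) mono_PF ?_ ?_ ?_ ?_ ?_ ?_ ?_ ?_ h2 (J.right ⟨rfl, h1, h1'⟩)
  · rintro p c G ⟨h, -⟩; cases d <;> cases h
  · intros; contradiction
  · rintro c G ⟨h, -⟩; cases d <;> cases h
  · intros; contradiction
  · rintro A' B' c G ⟨h, -⟩; cases d <;> cases h
  · intros; contradiction
  · rintro d' A' c c1 G ⟨h, k, -⟩ hd k1
    obtain ⟨rfl, rfl⟩ := boxd_inj h
    refine hA.last (weak k ?_) k1
    exact Le.cons' hd.symm (Set.empty_subset _) (by simp [Comp.addR]) (Le.refl _)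
  · rintro d' A' c c1 G ⟨h, -, k⟩ hd k1
    obtain ⟨rfl, rfl⟩ := boxd_inj h
    exact hA.inner (k _ _ rfl hd) k1

theorem cut_box (d : Dir) (A : Formula) (hA : Cut A) : Cut (boxd d A) := by
  intro S S' h hJ
  refine gen mono_PF (mono_CutR _) ?_ ?_ ?_ ?_ ?_ ?_ ?_ ?_ h hJ
  · intros; contradiction
  · rintro p c G - ⟨h, -⟩; cases d <;> cases h
  · intros; contradiction
  · rintro A' B' c G ⟨h, -⟩; cases d <;> cases h
  · intros; contradiction
  · rintro d' A' c G ⟨h, k⟩ k1 k2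
    obtain ⟨rfl, rfl⟩ := boxd_inj h
    exact box_right hA k1 k2 k
  · intros; contradiction
  · intros; contradiction

theorem cut_imp (A B : Formula) (hA : Cut A) (hB : Cut B) : Cut (A.imp B) := by
  intro S S' h hJ
  refine gen mono_PF (mono_CutR _) ?_ ?_ ?_ ?_ ?_ ?_ ?_ ?_ h hJ
  · intros; contradiction
  · rintro p c G - ⟨h, -⟩; cases h
  · intros; contradiction
  · rintro A' B' c G ⟨h, k⟩ k1
    cases h
    exact imp_right hA hB k1 k
  · intros; contradiction
  · rintro d A' c G ⟨h, -⟩; cases d <;> cases h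
  · intros; contradiction
  · intros; contradiction

/-- Formulae that are never principal on the right, except possibly in axioms. -/
theorem cut_other (A : Formula) (h1 : ∀ B C, Formula.imp B C ≠ A) (h2 : ∀ d B, boxd d B ≠ A) : Cut A := by
  intro S S' h hJ
  refine gen mono_PF (mono_CutR _) ?_ ?_ ?_ ?_ ?_ ?_ ?_ ?_ h hJ
  · intros; contradiction
  · rintro p c G hp ⟨rfl, k⟩
    exact weak k (Le.cons' rfl (Set.insert_subset hp subset_rfl) subset_rfl (Le.refl _))
  · intros; contradiction
  · rintro A' B' c G ⟨h, k⟩; exact absurd h (h1 _ _)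
  · intros; contradiction
  · rintro d A' c G ⟨h, -⟩; exact absurd h (h2 _ _)
  · intros; contradiction
  · intros; contradiction

theorem cut_all (A : Formula) : Cut A := by
  induction A with
  | imp A B hA hB => exact cut_imp A B hA hB
  | box A h => exact cut_box .up A h
  | bbox A h => exact cut_box .dn A h
  | _ => exact cut_other _ (by simp) (by intro d B; cases d <;> simp [boxd])

/-! ### Translation -/

def dirOf : Ctx → Dir
  | [] => .up
  | (_, _, d) :: _ => d

/-- The multiset as a set. -/
def st (Γ : Multiset Formula) : Set Formula := {X | X ∈ Γ}

/-- Translation of a reversed context. -/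
def seqs : Ctx → List Comp
  | [] => []
  | (Γ, Δ, _) :: R => ⟨st Γ, st Δ, dirOf R⟩ :: seqs R

def rev : List Comp → Dir → LNS → List Comp
  | G, d, .single Γ Δ => ⟨st Γ, st Δ, d⟩ :: G
  | G, d, .up Γ Δ S => rev (⟨st Γ, st Δ, d⟩ :: G) .up S
  | G, d, .dn Γ Δ S => rev (⟨st Γ, st Δ, d⟩ :: G) .dn S

theorem rev_plug (G R : Ctx) (S : LNS) : rev (seqs R) (dirOf R) (plug G S) =
    rev (seqs (G.reverse ++ R)) (dirOf (G.reverse ++ R)) S := by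
  induction G generalizing R with
  | nil => rfl
  | cons g G ih =>
    obtain ⟨Γ, Δ, d⟩ := g
    have := ih ((Γ, Δ, d) :: R)
    cases d <;> simpa [plug, rev, seqs, dirOf] using this

def tr (S : LNS) : List Comp := rev [] .up S

theorem tr_plug (G : Ctx) (S : LNS) :
    tr (plug G S) = rev (seqs G.reverse) (dirOf G.reverse) S := by
  simpa [seqs, dirOf, tr] using rev_plug G [] S

theorem st_cons (A : Formula) (Γ : Multiset Formula) : st (A ::ₘ Γ) = insert A (st Γ) := by
  ext X; simp [st]

theorem st_zero : st 0 = ∅ := by ext X; simp [st]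
theorem st_single (A : Formula) : st {A} = {A} := by ext X; simp [st]

theorem plug_append (G H : Ctx) (S : LNS) : plug (G ++ H) S = plug G (plug H S) := by
  induction G with
  | nil => rfl
  | cons g G ih => obtain ⟨Γ, Δ, d⟩ := g; cases d <;> simp [plug, ih]

theorem lastDir_snoc (G : Ctx) (Γ Δ : Multiset Formula) (d : Dir) :
    lastDir (G ++ [(Γ, Δ, d)]) = some d := by
  induction G with
  | nil => rfl
  | cons g G ih =>
    cases G with
    | nil => rfl
    | cons g' G => simpa [lastDir] using ih

theorem dir_cases (G : Ctx) (d : Dir) (h : lastDir G ≠ some (flip d)) :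
    seqs G.reverse = [] ∨ dirOf G.reverse = d := by
  induction G using List.reverseRecOn with
  | nil => left; rfl
  | append_singleton G g _ =>
    obtain ⟨Γ, Δ, e⟩ := g
    rw [lastDir_snoc] at h
    right
    cases d <;> cases e <;> simp_all [flip, dirOf]

theorem sound {S : LNS} (h : Deriv S) : SD (tr S) := by
  induction h with
  | id G Γ Δ p =>
    rw [tr_plug]; exact .id p _ _ (by simp [st]) (by simp [st])
  | botL G Γ Δ => rw [tr_plug]; exact .bot _ _ (by simp [st])
  | ew G Θ Λ d Γ Δ _ ih =>
    rw [tr_plug] at ih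
    rw [tr_plug, List.reverse_append]
    exact .ew _ _ _ ih
  | impR G Γ Δ A B _ ih =>
    rw [tr_plug] at ih ⊢
    refine .impR A B _ _ (by simp [st]) ?_
    simpa [rev, st_cons, Comp.addL, Comp.addR] using ih
  | impL G Γ Δ A B _ _ ih1 ih2 =>
    rw [tr_plug] at ih1 ih2 ⊢
    refine .impL A B _ _ (by simp [st]) ?_ ?_
    · simpa [rev, st_cons, Comp.addL, Comp.addR] using ih1
    · simpa [rev, st_cons, Comp.addL, Comp.addR] using ih2
  | boxR1 G Γ Δ Θ Λ A _ _ ih1 ih2 =>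
    rw [tr_plug] at ih1 ih2 ⊢
    refine .boxR .up A _ _ (by simp [st, boxd]) ?_ ?_
    · simpa [rev, st_cons, st_zero, st_single] using ih2
    · rintro c1 G1 h -
      cases h
      simpa [rev, st_cons, Comp.addL, Comp.addR] using ih1
  | bboxR1 G Γ Δ Θ Λ A _ _ ih1 ih2 =>
    rw [tr_plug] at ih1 ih2 ⊢
    refine .boxR .dn A _ _ (by simp [st, boxd]) ?_ ?_
    · simpa [rev, st_cons, st_zero, st_single] using ih2
    · rintro c1 G1 h -
      cases h
      simpa [rev, st_cons, Comp.addL, Comp.addR] using ih1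
  | boxR2 G Γ Δ A hd _ ih =>
    rw [tr_plug] at ih ⊢
    refine .boxR .up A _ _ (by simp [st, boxd]) ?_ ?_
    · simpa [rev, st_cons, st_zero, st_single] using ih
    · intro c1 G1 h h'
      rcases dir_cases G .up hd with k | k
      · rw [k] at h; cases h
      · simp [k, flip] at h'
  | bboxR2 G Γ Δ A hd _ ih =>
    rw [tr_plug] at ih ⊢
    refine .boxR .dn A _ _ (by simp [st, boxd]) ?_ ?_
    · simpa [rev, st_cons, st_zero, st_single] using ih
    · intro c1 G1 h h'
      rcases dir_cases G .dn hd with k | k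
      · rw [k] at h; cases h
      · simp [k, flip] at h'
  | boxL1 G Γ Δ Θ Λ A _ ih =>
    rw [tr_plug] at ih ⊢
    refine .boxL1 .up A _ _ _ rfl (by simp [st, boxd]) ?_
    simpa [rev, st_cons, Comp.addL, Comp.addR] using ih
  | bboxL1 G Γ Δ Θ Λ A _ ih =>
    rw [tr_plug] at ih ⊢
    refine .boxL1 .dn A _ _ _ rfl (by simp [st, boxd]) ?_
    simpa [rev, st_cons, Comp.addL, Comp.addR] using ih
  | boxL2 G Γ Δ Θ Λ A _ ih =>
    rw [tr_plug] at ih ⊢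
    refine .boxL2 .up A _ _ _ rfl (by simp [st, boxd]) ?_
    simpa [rev, st_cons, Comp.addL, Comp.addR] using ih
  | bboxL2 G Γ Δ Θ Λ A _ ih =>
    rw [tr_plug] at ih ⊢
    refine .boxL2 .dn A _ _ _ rfl (by simp [st, boxd]) ?_
    simpa [rev, st_cons, Comp.addL, Comp.addR] using ih

theorem st_mem {A : Formula} {Γ : Multiset Formula} (h : A ∈ st Γ) : ∃ Γ', Γ = A ::ₘ Γ' :=
  Multiset.exists_cons_of_mem h

theorem complete {S : List Comp} (h : SD S) : ∀ (R : Ctx) (Γ Δ : Multiset Formula),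
    ⟨st Γ, st Δ, dirOf R⟩ :: seqs R = S → Deriv (plug R.reverse (.single Γ Δ)) := by
  induction h with
  | id p c G h1 h2 =>
    rintro R Γ Δ h
    cases h
    obtain ⟨Γ, rfl⟩ := st_mem h1
    obtain ⟨Δ, rfl⟩ := st_mem h2
    exact .id _ _ _ _
  | bot c G h1 =>
    rintro R Γ Δ h
    cases h
    obtain ⟨Γ, rfl⟩ := st_mem h1
    exact .botL _ _ _
  | ew c c1 G h1 ih =>
    rintro R Γ Δ h
    obtain _ | ⟨⟨Γ1, Δ1, e⟩, R⟩ := R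
    · cases h
    · cases h
      rw [List.reverse_cons]
      exact .ew _ _ _ _ _ _ (ih R Γ1 Δ1 rfl)
  | impR A B c G h1 h2 ih =>
    rintro R Γ Δ h
    cases h
    obtain ⟨Δ, rfl⟩ := st_mem h1
    exact .impR _ _ _ _ _ (ih R _ _ (by simp [st_cons, Comp.addL, Comp.addR]))
  | impL A B c G h1 h2 h3 ih1 ih2 =>
    rintro R Γ Δ h
    cases h
    obtain ⟨Γ, rfl⟩ := st_mem h1
    exact .impL _ _ _ _ _ (ih1 R _ _ (by simp [st_cons, Comp.addL]))
      (ih2 R _ _ (by simp [st_cons, Comp.addR]))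
  | boxR d A c G h1 h2 h3 ih1 ih2 =>
    rintro R Γ Δ h
    cases h
    obtain ⟨Δ, rfl⟩ := st_mem h1
    have k1 := ih1 ((Γ, boxd d A ::ₘ Δ, d) :: R) 0 {A}
      (by simp [st_zero, st_single, seqs, dirOf])
    rw [List.reverse_cons, plug_append] at k1
    obtain _ | ⟨⟨Γ1, Δ1, e⟩, R⟩ := R
    · cases d
      · exact .boxR2 _ _ _ _ (by simp [lastDir]) k1
      · exact .bboxR2 _ _ _ _ (by simp [lastDir]) k1
    · by_cases he : e = d
      · subst he
        cases e
        · exact .boxR2 _ _ _ _ (by rw [List.reverse_cons, lastDir_snoc]; simp) k1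
        · exact .bboxR2 _ _ _ _ (by rw [List.reverse_cons, lastDir_snoc]; simp) k1
      · have he' : e = flip d := by cases d <;> cases e <;> simp_all [flip]
        subst he'
        have k2 := ih2 _ _ rfl rfl ((Γ1, A ::ₘ Δ1, flip d) :: R) Γ (boxd d A ::ₘ Δ)
          (by simp [st_cons, seqs, dirOf, Comp.addR])
        rw [List.reverse_cons, plug_append] at k1 k2 ⊢
        cases d
        · exact .boxR1 _ _ _ _ _ _ k2 k1
        · exact .bboxR1 _ _ _ _ _ _ k2 k1
  | boxL1 d A c c1 G hd h1 h2 ih =>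
    rintro R Γ Δ h
    obtain _ | ⟨⟨Γ1, Δ1, e⟩, R⟩ := R
    · cases h
    · cases h
      simp only [dirOf] at hd
      subst hd
      obtain ⟨Γ1, rfl⟩ := st_mem h1
      have k := ih ((boxd e A ::ₘ Γ1, Δ1, e) :: R) (A ::ₘ Γ) Δ
        (by simp [st_cons, seqs, dirOf, Comp.addL])
      rw [List.reverse_cons, plug_append] at k ⊢
      cases e
      · exact .boxL1 _ _ _ _ _ _ k
      · exact .bboxL1 _ _ _ _ _ _ k
  | boxL2 d A c c1 G hd h1 h2 ih =>
    rintro R Γ Δ h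
    obtain _ | ⟨⟨Γ1, Δ1, e⟩, R⟩ := R
    · cases h
    · cases h
      obtain ⟨Γ, rfl⟩ := st_mem h1
      have k := ih R (A ::ₘ Γ1) Δ1 (by simp [st_cons, Comp.addL])
      rw [List.reverse_cons, plug_append]
      simp only [dirOf] at hd
      subst hd
      cases d
      · exact .boxL2 _ _ _ _ _ _ k
      · exact .bboxL2 _ _ _ _ _ _ k

/-- Componentwise inclusion of contexts. -/
def CLe (G K : Ctx) : Prop :=
  List.Forall₂ (fun a b => a.1 ≤ b.1 ∧ a.2.1 ≤ b.2.1 ∧ a.2.2 = b.2.2) G K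

theorem merge_ctx (G H : Ctx) (Γ Δ Θ Λ Γ' Δ' Θ' Λ' : Multiset Formula)
    (h : structEquiv (plug G (.single Γ' Δ')) (plug H (.single Θ' Λ'))) :
    ∃ K, CLe G K ∧ CLe H K ∧ merge (plug G (.single Γ Δ)) (plug H (.single Θ Λ)) =
      plug K (.single (Γ + Θ) (Δ + Λ)) := by
  induction G generalizing H with
  | nil =>
    obtain _ | ⟨⟨Γ1, Δ1, d⟩, H⟩ := H
    · exact ⟨[], .nil, .nil, rfl⟩
    · cases d <;> exact h.elim
  | cons g G ih =>
    obtain ⟨Γ1, Δ1, d⟩ := g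
    obtain _ | ⟨⟨Γ2, Δ2, e⟩, H⟩ := H
    · cases d <;> exact h.elim
    · cases d <;> cases e
      · obtain ⟨K, k1, k2, k3⟩ := ih H h
        exact ⟨(Γ1 + Γ2, Δ1 + Δ2, .up) :: K, .cons (by simp) k1, .cons (by simp) k2,
          by simp [plug, merge, k3]⟩
      · exact h.elim
      · exact h.elim
      · obtain ⟨K, k1, k2, k3⟩ := ih H h
        exact ⟨(Γ1 + Γ2, Δ1 + Δ2, .dn) :: K, .cons (by simp) k1, .cons (by simp) k2,
          by simp [plug, merge, k3]⟩

theorem st_mono {Γ Δ : Multiset Formula} (h : Γ ≤ Δ) : st Γ ⊆ st Δ :=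
  fun _ hX => Multiset.mem_of_le h hX

theorem seqs_le {G K : Ctx} (h : CLe G K) : dirOf G = dirOf K ∧ Le (seqs G) (seqs K) := by
  induction h with
  | nil => exact ⟨rfl, .nil⟩
  | cons h1 h2 ih =>
    exact ⟨h1.2.2, Le.cons' ih.1 (st_mono h1.1) (st_mono h1.2.1) ih.2⟩

end Aux

/-- Cut elimination for LNS_Kt: from derivations of `G ⇗ Γ ⇒ Δ,A` and
`H ⇗ A,Θ ⇒ Λ` (structurally equivalent) we get a derivation of
`(G ⊕ H) ⇗ Γ,Θ ⇒ Δ,Λ`. -/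
theorem cut_elimination (G H : Ctx) (Γ Δ Θ Λ : Multiset Formula) (A : Formula)
    (h1 : Deriv (plug G (.single Γ (A ::ₘ Δ))))
    (h2 : Deriv (plug H (.single (A ::ₘ Θ) Λ)))
    (hse : structEquiv (plug G (.single Γ (A ::ₘ Δ))) (plug H (.single (A ::ₘ Θ) Λ))) :
    Deriv (merge (plug G (.single Γ Δ)) (plug H (.single Θ Λ))) := by
  obtain ⟨K, k1, k2, k3⟩ := Aux.merge_ctx G H Γ Δ Θ Λ _ _ _ _ hse
  rw [k3]
  have e1 := Aux.seqs_le (List.rel_reverse k1)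
  have e2 := Aux.seqs_le (List.rel_reverse k2)
  have s1 := Aux.sound h1
  have s2 := Aux.sound h2
  rw [Aux.tr_plug] at s1 s2
  rw [← List.reverse_reverse K]
  refine Aux.complete ((Aux.cut_all A).last (Aux.weak s1 ?_) (Aux.weak s2 ?_)) _ _ _ rfl
  · refine Aux.Le.cons' e1.1 (Aux.st_mono (by simp)) ?_ e1.2
    rw [Aux.st_cons]
    exact Set.insert_subset_insert (Aux.st_mono (by simp))
  · refine Aux.Le.cons' e2.1 ?_ (Aux.st_mono (by simp)) e2.2
    rw [Aux.st_cons]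
    exact Set.insert_subset_insert (Aux.st_mono (by simp))
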